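/- arXiv:2409.18886 — 9 statements merged into one kernel-verified Lean document; each statement's English description precedes it below -/
import Mathlib

section
/- For every fixed n ≥ 0, the row of the 2-Pascal triangle is log-concave: writing C_2(n,k) for the coefficient of x^k in (1 + x + x^2)^n, one has C_2(n,k)^2 ≥ C_2(n,k-1) · C_2(n,k+1) for all k ≥ 1. -/
open Polynomial

/-- The coefficients of a polynomial, extended by zero to all integer indices. -/
noncomputable def intCoeff (p : ℝ[X]) (i : ℤ) : ℝ :=
  if 0 ≤ i then p.coeff i.toNat else 0

lemma intCoeff_natCast (p : ℝ[X]) (k : ℕ) : intCoeff p k = p.coeff k := by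
  simp [intCoeff]

lemma intCoeff_add (p q : ℝ[X]) (i : ℤ) :
    intCoeff (p + q) i = intCoeff p i + intCoeff q i := by
  unfold intCoeff
  split_ifs <;> simp

lemma intCoeff_mul_X (p : ℝ[X]) (i : ℤ) : intCoeff (p * X) i = intCoeff p (i - 1) := by
  unfold intCoeff
  rcases lt_trichotomy i 0 with h | rfl | h
  · rw [if_neg (by lia), if_neg (by lia)]
  · simp
  · rw [if_pos (by lia), if_pos (by lia), show i.toNat = (i - 1).toNat + 1 by lia, coeff_mul_X]

lemma intCoeff_one (i : ℤ) : intCoeff 1 i = if i = 0 then 1 else 0 := by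
  unfold intCoeff
  rw [coeff_one]
  split_ifs <;> first | rfl | lia

/-- The strong form of log-concavity (total positivity of order two) of a two-sided sequence
is preserved by convolution with `1, 1, 1`. -/
lemma mul_le_mul_of_three_term_sum {a b : ℤ → ℝ}
    (ha : ∀ i j, i ≤ j → a (i - 1) * a (j + 1) ≤ a i * a j)
    (hb : ∀ i, b i = a i + a (i - 1) + a (i - 2)) (i j : ℤ) (hij : i ≤ j) :
    b (i - 1) * b (j + 1) ≤ b i * b j := by
  have key (u v : ℤ) (h : i - u ≤ j - v) :
      a (i - (u + 1)) * a (j + (1 - v)) ≤ a (i - u) * a (j - v) := by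
    convert ha _ _ h using 3 <;> ring
  have h00 := key 0 0
  have h01 := key 0 1
  have h02 := key 0 2
  have h10 := key 1 0 (by lia)
  have h11 := key 1 1 (by lia)
  have h12 := key 1 2
  have h20 := key 2 0 (by lia)
  have h21 := key 2 1 (by lia)
  have h22 := key 2 2 (by lia)
  simp only [hb]
  obtain rfl | rfl | h : j = i ∨ j = i + 1 ∨ i + 2 ≤ j := by lia
  · specialize h00 (by lia)
    ring_nf at *
    linarith
  · specialize h00 (by lia)
    specialize h01 (by lia)
    specialize h12 (by lia)
    ring_nf at *
    linarith
  · specialize h00 (by lia)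
    specialize h01 (by lia)
    specialize h02 (by lia)
    specialize h12 (by lia)
    ring_nf at *
    linarith

lemma intCoeff_trinomial_pow_mul_le (n : ℕ) : ∀ i j : ℤ, i ≤ j →
    intCoeff ((1 + X + X ^ 2) ^ n) (i - 1) * intCoeff ((1 + X + X ^ 2) ^ n) (j + 1) ≤
      intCoeff ((1 + X + X ^ 2) ^ n) i * intCoeff ((1 + X + X ^ 2) ^ n) j := by
  induction n with
  | zero =>
    intro i j hij
    simp only [pow_zero, intCoeff_one]
    split_ifs <;> first | lia | norm_num
  | succ n ih =>
    refine mul_le_mul_of_three_term_sum ih fun i => ?_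
    rw [pow_succ, show ((1 + X + X ^ 2 : ℝ[X]) ^ n) * (1 + X + X ^ 2) =
      (1 + X + X ^ 2) ^ n + (1 + X + X ^ 2) ^ n * X + (1 + X + X ^ 2) ^ n * X * X by ring,
      intCoeff_add, intCoeff_add, intCoeff_mul_X, intCoeff_mul_X, intCoeff_mul_X,
      show i - 1 - 1 = i - 2 by ring]

/-- Each row of the 2-Pascal triangle (coefficients of `(1 + x + x^2)^n`) is
log-concave. -/
theorem stmt_2 :
    ∀ n k : ℕ, 1 ≤ k →
      (((1 + X + X ^ 2 : ℝ[X]) ^ n).coeff (k - 1)) *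
          (((1 + X + X ^ 2 : ℝ[X]) ^ n).coeff (k + 1)) ≤
        (((1 + X + X ^ 2 : ℝ[X]) ^ n).coeff k) ^ 2 := by
  intro n k hk
  have h := intCoeff_trinomial_pow_mul_le n k k le_rfl
  rw [show (k : ℤ) - 1 = ((k - 1 : ℕ) : ℤ) by lia,
    show (k : ℤ) + 1 = ((k + 1 : ℕ) : ℤ) by lia] at h
  simpa only [intCoeff_natCast, ← sq] using h
end

section
/- Let α, β, γ, e, f, g, h be nonnegative real constants and define the array [A_{n,k}]_{n,k≥0} by A_{0,0} = 1, A_{0,k} = 0 for k > 0, and for n ≥ 1: A_{n,0} = α A_{n-1,0} + g A_{n-1,1} + h A_{n-1,2}; A_{n,1} = β A_{n-1,0} + f A_{n-1,1} + g A_{n-1,2} + h A_{n-1,3}; and A_{n,k} = γ A_{n-1,k-2} + e A_{n-1,k-1} + f A_{n-1,k} + g A_{n-1,k+1} + h A_{n-1,k+2} for k ≥ 2 (terms with out-of-range index being zero). Suppose (1) f ≥ α, e ≥ β, g ≥ 0 and h ≥ 0; (2) αf ≥ βg ≥ γh and f^2 ≥ eg ≥ γh; (3) αe ≥ γg, ef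 ≥ γg and βf ≥ γg; (4) βe ≥ γf, αg ≥ βh, g^2 ≥ fh and fg ≥ eh. Then the row generating functions A_n(q) = Σ_{k=0}^{2n} A_{n,k} q^k, n ≥ 0, form a strongly q-log-convex sequence. -/
open Polynomial

/-- Production matrix of the array: row `i`, column `k`. -/
def pentaEntry (α β γ e f g h : ℝ) (i k : ℕ) : ℝ :=
  if i = k + 2 then h else if i = k + 1 then g
  else if i = k then (if k = 0 then α else f)
  else if k = i + 1 then (if i = 0 then β else e)
  else if k = i + 2 then γ else 0

theorem two_mul_sum_minor {R : Type*} [CommRing R] (N : ℕ) (x y a b : ℕ → R) :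
    2 * ((∑ i ∈ Finset.range N, x i * a i) * (∑ j ∈ Finset.range N, y j * b j)
      - (∑ i ∈ Finset.range N, x i * b i) * (∑ j ∈ Finset.range N, y j * a j))
    = ∑ i ∈ Finset.range N, ∑ j ∈ Finset.range N,
        (x i * y j - x j * y i) * (a i * b j - a j * b i) := by
  have key : ∀ u v : ℕ → R, (∑ i ∈ Finset.range N, u i) * (∑ j ∈ Finset.range N, v j)
      = ∑ i ∈ Finset.range N, ∑ j ∈ Finset.range N, u i * v j :=
    fun u v => Finset.sum_mul_sum _ _ _ _
  have key' : ∀ u v : ℕ → R, (∑ i ∈ Finset.range N, u i) * (∑ j ∈ Finset.range N, v j)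
      = ∑ i ∈ Finset.range N, ∑ j ∈ Finset.range N, u j * v i := fun u v => by
    rw [key, Finset.sum_comm]
  rw [two_mul]
  nth_rewrite 1 [key, key]
  rw [key', key']
  simp only [← Finset.sum_sub_distrib, ← Finset.sum_add_distrib]
  exact Finset.sum_congr rfl fun i _ => Finset.sum_congr rfl fun j _ => by ring

theorem sum_minor_nonneg (N : ℕ) (x y a b : ℕ → ℝ)
    (hxy : ∀ i j, i < j → x j * y i ≤ x i * y j)
    (hab : ∀ i j, i < j → a j * b i ≤ a i * b j) :
    (∑ i ∈ Finset.range N, x i * b i) * (∑ j ∈ Finset.range N, y j * a j)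
      ≤ (∑ i ∈ Finset.range N, x i * a i) * (∑ j ∈ Finset.range N, y j * b j) := by
  have h2 := two_mul_sum_minor N x y a b
  have h0 : 0 ≤ ∑ i ∈ Finset.range N, ∑ j ∈ Finset.range N,
        (x i * y j - x j * y i) * (a i * b j - a j * b i) := by
    refine Finset.sum_nonneg fun i _ => Finset.sum_nonneg fun j _ => ?_
    rcases lt_trichotomy i j with hij | rfl | hij
    · exact mul_nonneg (sub_nonneg.2 (hxy i j hij)) (sub_nonneg.2 (hab i j hij))
    · simp
    · exact mul_nonneg_of_nonpos_of_nonpos (sub_nonpos.2 (hxy j i hij))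
        (sub_nonpos.2 (hab j i hij))
  linarith

theorem coeff_sum_minor_nonneg (N t : ℕ) (x y : ℕ → ℝ) (a b : ℕ → ℝ[X])
    (hxy : ∀ i j, i < j → x j * y i ≤ x i * y j)
    (hab : ∀ i j, i < j → 0 ≤ (a i * b j - a j * b i).coeff t) :
    0 ≤ ((∑ i ∈ Finset.range N, C (x i) * a i) * (∑ j ∈ Finset.range N, C (y j) * b j)
      - (∑ i ∈ Finset.range N, C (x i) * b i)
        * (∑ j ∈ Finset.range N, C (y j) * a j)).coeff t := by
  have h2 := congrArg (fun p => coeff p t)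
    (two_mul_sum_minor N (fun i => C (x i)) (fun i => C (y i)) a b)
  simp only [← C_mul, ← C_sub, finsetSum_coeff, coeff_C_mul] at h2
  rw [← C_ofNat, coeff_C_mul] at h2
  have h0 : 0 ≤ ∑ i ∈ Finset.range N, ∑ j ∈ Finset.range N,
        (x i * y j - x j * y i) * (a i * b j - a j * b i).coeff t := by
    refine Finset.sum_nonneg fun i _ => Finset.sum_nonneg fun j _ => ?_
    rcases lt_trichotomy i j with hij | rfl | hij
    · exact mul_nonneg (sub_nonneg.2 (hxy i j hij)) (hab i j hij)
    · simp
    · refine mul_nonneg_of_nonpos_of_nonpos (sub_nonpos.2 (hxy j i hij)) ?_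
      have := hab j i hij
      rw [← neg_sub, coeff_neg] at this
      linarith
  linarith

section

variable {α β γ e f g h : ℝ}

theorem pentaEntry_nonneg (hα : 0 ≤ α) (hβ : 0 ≤ β) (hγ : 0 ≤ γ) (he : 0 ≤ e) (hf : 0 ≤ f)
    (hg : 0 ≤ g) (hh : 0 ≤ h) (i k : ℕ) : 0 ≤ pentaEntry α β γ e f g h i k := by
  unfold pentaEntry
  split_ifs <;> first | assumption | exact le_rfl

theorem pentaEntry_le_shift (hβ : 0 ≤ β) (hγ : 0 ≤ γ) (hg : 0 ≤ g) (hh : 0 ≤ h)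
    (he : 0 ≤ e) (hf : 0 ≤ f) (h1a : α ≤ f) (h1b : β ≤ e) (i k d : ℕ) :
    pentaEntry α β γ e f g h i k ≤ pentaEntry α β γ e f g h (i + d) (k + d) := by
  unfold pentaEntry
  split_ifs <;> first | omega | assumption | exact le_rfl

theorem pentaEntry_eq_zero_of_add_two_lt {i k : ℕ} (hik : i + 2 < k ∨ k + 2 < i) :
    pentaEntry α β γ e f g h i k = 0 := by
  unfold pentaEntry
  split_ifs <;> first | omega | rfl

theorem pentaEntry_minor_nonneg (hα : 0 ≤ α) (hβ : 0 ≤ β) (hγ : 0 ≤ γ) (he : 0 ≤ e)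
    (hf : 0 ≤ f) (hg : 0 ≤ g) (hh : 0 ≤ h) (h1b : β ≤ e)
    (h2a : β * g ≤ α * f) (h2b : γ * h ≤ β * g)
    (h2c : e * g ≤ f ^ 2) (h2d : γ * h ≤ e * g)
    (h3a : γ * g ≤ α * e) (h3b : γ * g ≤ e * f) (h3c : γ * g ≤ β * f)
    (h4a : γ * f ≤ β * e) (h4b : β * h ≤ α * g) (h4c : f * h ≤ g ^ 2)
    (h4d : e * h ≤ f * g) {i j k l : ℕ} (hij : i < j) (hkl : k < l) :
    pentaEntry α β γ e f g h i l * pentaEntry α β γ e f g h j k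
      ≤ pentaEntry α β γ e f g h i k * pentaEntry α β γ e f g h j l := by
  have hP := pentaEntry_nonneg hα hβ hγ he hf hg hh
  have hr := mul_nonneg (hP i k) (hP j l)
  have hee : γ * f ≤ e * e := h4a.trans (mul_le_mul_of_nonneg_right h1b he)
  by_cases hl : i + 2 < l
  · rwa [pentaEntry_eq_zero_of_add_two_lt (Or.inl hl), zero_mul]
  by_cases hj : k + 2 < j
  · rwa [pentaEntry_eq_zero_of_add_two_lt (i := j) (Or.inr hj), mul_zero]
  clear hr hP
  have hcases : (k = i + 1 ∧ l = i + 2 ∧ (j = i + 1 ∨ j = i + 2 ∨ j = i + 3)) ∨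
      (k = i ∧ (l = i + 1 ∨ l = i + 2) ∧ (j = i + 1 ∨ j = i + 2)) ∨
      (i = k + 1 ∧ (l = k + 1 ∨ l = k + 2 ∨ l = k + 3) ∧ j = k + 2) := by omega
  rcases hcases with ⟨rfl, rfl, rfl | rfl | rfl⟩ | ⟨rfl, rfl | rfl, rfl | rfl⟩ |
    ⟨rfl, rfl | rfl | rfl, rfl⟩ <;>
  simp [pentaEntry, add_assoc] <;> (try split_ifs) <;> linarith

end

/-- A vector supported in `range N`, multiplied by the production matrix. -/
theorem sum_mul_pentaEntry (α β γ e f g h : ℝ) {N : ℕ} {x : ℕ → ℝ}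
    (hx : ∀ i, N ≤ i → x i = 0) (k : ℕ) :
    ∑ i ∈ Finset.range N, x i * pentaEntry α β γ e f g h i k =
      (if 2 ≤ k then γ * x (k - 2) else 0)
      + (if k = 0 then 0 else (if k = 1 then β else e) * x (k - 1))
      + (if k = 0 then α else f) * x k + g * x (k + 1) + h * x (k + 2) := by
  have hone : ∀ (c : ℝ) (a : ℕ),
      ∑ i ∈ Finset.range N, (if i = a then c * x a else 0) = c * x a := fun c a => by
    rw [Finset.sum_ite_eq']
    split_ifs with ha
    · rfl
    · rw [hx a (by simpa using ha), mul_zero]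
  have hdecomp : ∀ i, x i * pentaEntry α β γ e f g h i k =
      (if i = k - 2 then (if 2 ≤ k then γ else 0) * x (k - 2) else 0)
      + (if i = k - 1 then (if k = 0 then 0 else if k = 1 then β else e) * x (k - 1) else 0)
      + (if i = k then (if k = 0 then α else f) * x k else 0)
      + (if i = k + 1 then g * x (k + 1) else 0)
      + (if i = k + 2 then h * x (k + 2) else 0) := fun i => by
    unfold pentaEntry
    rcases k with _ | _ | k
    · rcases i with _ | _ | _ | i <;> simp <;> ring
    · rcases i with _ | _ | _ | _ | i <;> simp <;> ring
    · by_cases c1 : i = k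
      · subst c1; simp [add_assoc]; ring
      by_cases c2 : i = k + 1
      · subst c2; simp [add_assoc]; ring
      by_cases c3 : i = k + 2
      · subst c3; simp [add_assoc]; ring
      by_cases c4 : i = k + 3
      · subst c4; simp [add_assoc]; ring
      by_cases c5 : i = k + 4
      · subst c5; simp [add_assoc]; ring
      simp [c1, c2, c3, c4, c5, Ne.symm c1, Ne.symm c2]
  rw [Finset.sum_congr rfl fun i _ => hdecomp i]
  simp only [Finset.sum_add_distrib, hone]
  congr 4 <;> split_ifs <;> simp

/-- Under conditions (1)-(4), the generating functions of the rows of the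
generalized triangular array form a strongly `q`-log-convex sequence. -/
theorem stmt_3 (α β γ e f g h : ℝ) (A : ℕ → ℕ → ℝ)
    (hα : 0 ≤ α) (hβ : 0 ≤ β) (hγ : 0 ≤ γ) (he : 0 ≤ e) (hf : 0 ≤ f)
    (hg : 0 ≤ g) (hh : 0 ≤ h)
    (hA00 : A 0 0 = 1)
    (hA0k : ∀ k : ℕ, 0 < k → A 0 k = 0)
    (hAhigh : ∀ n k : ℕ, 2 * n < k → A n k = 0)
    (hrec0 : ∀ n : ℕ, 1 ≤ n →
      A n 0 = α * A (n - 1) 0 + g * A (n - 1) 1 + h * A (n - 1) 2)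
    (hrec1 : ∀ n : ℕ, 1 ≤ n →
      A n 1 = β * A (n - 1) 0 + f * A (n - 1) 1 + g * A (n - 1) 2 + h * A (n - 1) 3)
    (hrec : ∀ n : ℕ, 1 ≤ n → ∀ k : ℕ, 2 ≤ k →
      A n k = γ * A (n - 1) (k - 2) + e * A (n - 1) (k - 1) + f * A (n - 1) k
        + g * A (n - 1) (k + 1) + h * A (n - 1) (k + 2))
    (h1a : α ≤ f) (h1b : β ≤ e)
    (h2a : β * g ≤ α * f) (h2b : γ * h ≤ β * g)
    (h2c : e * g ≤ f ^ 2) (h2d : γ * h ≤ e * g)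
    (h3a : γ * g ≤ α * e) (h3b : γ * g ≤ e * f) (h3c : γ * g ≤ β * f)
    (h4a : γ * f ≤ β * e) (h4b : β * h ≤ α * g) (h4c : f * h ≤ g ^ 2)
    (h4d : e * h ≤ f * g)
    (Aq : ℕ → ℝ[X])
    (hAq : ∀ n : ℕ, Aq n = ∑ k ∈ Finset.range (2 * n + 1), C (A n k) * X ^ k) :
    ∀ m n : ℕ, 1 ≤ n → n ≤ m → ∀ t : ℕ,
      0 ≤ (Aq (n - 1) * Aq (m + 1) - Aq n * Aq m).coeff t := by
  set P := pentaEntry α β γ e f g h with hPdef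
  have hPnn : ∀ i k, 0 ≤ P i k := pentaEntry_nonneg hα hβ hγ he hf hg hh
  have hstep : ∀ n N k : ℕ, 2 * n < N →
      A (n + 1) k = ∑ i ∈ Finset.range N, A n i * P i k := fun n N k hN => by
    rw [hPdef, sum_mul_pentaEntry α β γ e f g h fun i hi => hAhigh n i (by omega)]
    rcases k with _ | _ | k
    · rw [hrec0 (n + 1) (by omega)]; simp
    · rw [hrec1 (n + 1) (by omega)]; simp
    · rw [hrec (n + 1) (by omega) (k + 2) (by omega)]; simp
  have hAnn : ∀ n k, 0 ≤ A n k := fun n => by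
    induction n with
    | zero =>
      intro k
      rcases k with _ | k
      · rw [hA00]; exact zero_le_one
      · rw [hA0k _ k.succ_pos]
    | succ n ih =>
      intro k
      rw [hstep n (2 * n + 1) k (by omega)]
      exact Finset.sum_nonneg fun i _ => mul_nonneg (ih i) (hPnn i k)
  have hAminor : ∀ n d i j, i < j → A n j * A (n + d) i ≤ A n i * A (n + d) j := fun n d => by
    induction n with
    | zero =>
      intro i j hij
      rw [hA0k j (by omega), zero_mul]
      exact mul_nonneg (hAnn _ _) (hAnn _ _)
    | succ n ih =>
      intro i j hij
      rw [show n + 1 + d = n + d + 1 by omega]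
      simp only [hstep n (2 * (n + d) + 1) _ (by omega),
        hstep (n + d) (2 * (n + d) + 1) _ (by omega)]
      refine sum_minor_nonneg _ _ _ _ _ ih fun k l hkl => ?_
      rw [mul_comm]
      exact (pentaEntry_minor_nonneg hα hβ hγ he hf hg hh h1b h2a h2b h2c h2d h3a h3b h3c
        h4a h4b h4c h4d hkl hij)
  have hcoeff : ∀ n k, (Aq n).coeff k = A n k := fun n k => by
    rw [hAq]
    simp only [finsetSum_coeff, coeff_C_mul_X_pow, Finset.sum_ite_eq, Finset.mem_range]
    split_ifs with hk
    · rfl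
    · rw [hAhigh n k (by omega)]
  set B : ℕ → ℝ[X] := fun i => ∑ k ∈ Finset.range (i + 3), C (P i k) * X ^ k with hB
  have hBcoeff : ∀ i k, (B i).coeff k = P i k := fun i k => by
    simp only [hB, finsetSum_coeff, coeff_C_mul_X_pow, Finset.sum_ite_eq, Finset.mem_range]
    split_ifs with hk
    · rfl
    · exact (pentaEntry_eq_zero_of_add_two_lt (Or.inl (by omega))).symm
  have hAqX : ∀ n N : ℕ, 2 * n < N → Aq n = ∑ i ∈ Finset.range N, C (A n i) * X ^ i :=
    fun n N hN => by
      ext k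
      simp only [hcoeff, finsetSum_coeff, coeff_C_mul_X_pow, Finset.sum_ite_eq, Finset.mem_range]
      split_ifs with hk
      · rfl
      · exact hAhigh n k (by omega)
  have hAqB : ∀ n N : ℕ, 2 * n < N → Aq (n + 1) = ∑ i ∈ Finset.range N, C (A n i) * B i :=
    fun n N hN => by
      ext k
      simp only [hcoeff, finsetSum_coeff, coeff_C_mul, hBcoeff]
      exact hstep n N k hN
  intro m n hn hnm t
  obtain ⟨n, rfl⟩ : ∃ n', n = n' + 1 := ⟨n - 1, by omega⟩
  obtain ⟨d, rfl⟩ : ∃ d, m = n + d := ⟨m - n, by omega⟩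
  rw [Nat.add_sub_cancel, hAqX n (2 * (n + d) + 1) (by omega),
    hAqB (n + d) (2 * (n + d) + 1) (by omega), hAqB n (2 * (n + d) + 1) (by omega),
    hAqX (n + d) (2 * (n + d) + 1) (by omega)]
  refine coeff_sum_minor_nonneg _ _ _ _ _ _ (hAminor n d) fun i j hij => ?_
  rw [coeff_sub, coeff_X_pow_mul', coeff_X_pow_mul', hBcoeff, hBcoeff, sub_nonneg]
  split_ifs with hjt hit hit
  · have := pentaEntry_le_shift hβ hγ hg hh he hf h1a h1b i (t - j) (j - i)
    rwa [show i + (j - i) = j by omega, show t - j + (j - i) = t - i by omega] at this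
  · omega
  · exact hPnn _ _
  · exact le_rfl
end

section
/- Let s be a positive integer. If the sequence of real polynomials (x_n(q))_{n≥0} is strongly q-log-convex, then so is the sequence of window sums (y_k(q))_{k≥0} defined by y_k(q) = x_k(q) + x_{k+1}(q) + ⋯ + x_{k+s}(q). -/
open Polynomial

/-- In a strongly `q`-log-convex sequence, products with more spread indices dominate. -/
lemma coeff_mul_sub_mul_nonneg_of_le (x : ℕ → ℝ[X])
    (hx : ∀ m n : ℕ, 1 ≤ n → n ≤ m → ∀ t : ℕ,
      0 ≤ (x (n - 1) * x (m + 1) - x n * x m).coeff t) (t a k : ℕ) :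
    ∀ c : ℕ, a + k ≤ c → 0 ≤ (x a * x (c + k) - x (a + k) * x c).coeff t := by
  induction k with
  | zero => simp
  | succ k ih =>
    intro c hc
    have h₁ := ih (c + 1) (by omega)
    have h₂ := hx c (a + k + 1) (by omega) (by omega) t
    simp only [Nat.add_sub_cancel] at h₂
    rw [coeff_sub] at h₁ h₂ ⊢
    rw [show c + (k + 1) = c + 1 + k by ring, ← add_assoc a k 1]
    linarith

lemma coeff_mul_sub_mul_nonneg_of_add_eq (x : ℕ → ℝ[X])
    (hx : ∀ m n : ℕ, 1 ≤ n → n ≤ m → ∀ t : ℕ,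
      0 ≤ (x (n - 1) * x (m + 1) - x n * x m).coeff t) (t : ℕ) {a b c d : ℕ}
    (hab : a ≤ b) (hac : a ≤ c) (h : a + d = b + c) :
    0 ≤ (x a * x d - x b * x c).coeff t := by
  wlog hbc : b ≤ c generalizing b c
  · rw [mul_comm (x b)]
    exact this hac hab (by omega) (by omega)
  obtain ⟨k, rfl⟩ := Nat.exists_eq_add_of_le hab
  obtain rfl : d = c + k := by omega
  exact coeff_mul_sub_mul_nonneg_of_le x hx t a k c hbc

/-- Window sums of length `s + 1` preserve strong `q`-log-convexity. -/
theorem stmt_7 (s : ℕ) (hs : 1 ≤ s) (x : ℕ → ℝ[X])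
    (hx : ∀ m n : ℕ, 1 ≤ n → n ≤ m → ∀ t : ℕ,
      0 ≤ (x (n - 1) * x (m + 1) - x n * x m).coeff t)
    (y : ℕ → ℝ[X])
    (hy : ∀ k : ℕ, y k = ∑ j ∈ Finset.range (s + 1), x (k + j)) :
    ∀ m n : ℕ, 1 ≤ n → n ≤ m → ∀ t : ℕ,
      0 ≤ (y (n - 1) * y (m + 1) - y n * y m).coeff t := by
  intro m n hn hnm t
  obtain ⟨a, rfl⟩ := Nat.exists_eq_add_of_le' hn
  rw [Nat.add_sub_cancel]
  have hsucc (k : ℕ) : y (k + 1) = y k + x (k + (s + 1)) - x k := by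
    have h := Finset.sum_range_succ' (fun j => x (k + j)) (s + 1)
    rw [Finset.sum_range_succ, ← hy k] at h
    rw [h, hy (k + 1), add_zero, add_sub_cancel_right]
    exact Finset.sum_congr rfl fun j _ => by rw [add_assoc, add_comm 1 j]
  have key : y a * y (m + 1) - y (a + 1) * y m =
      ∑ j ∈ Finset.range (s + 1),
        ((x (a + j) * x (m + (s + 1)) - x (a + (s + 1)) * x (m + j)) +
          (x a * x (m + j) - x (a + j) * x m)) := by
    simp only [Finset.sum_add_distrib, Finset.sum_sub_distrib, ← Finset.sum_mul,
      ← Finset.mul_sum, ← hy, hsucc]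
    ring
  rw [key, finsetSum_coeff]
  refine Finset.sum_nonneg fun j hj => ?_
  have hj' := Finset.mem_range.mp hj
  rw [coeff_add]
  exact add_nonneg
    (coeff_mul_sub_mul_nonneg_of_add_eq x hx t (by omega) (by omega) (by omega))
    (coeff_mul_sub_mul_nonneg_of_add_eq x hx t (by omega) (by omega) (by omega))
end

section
/- Let s be a positive integer. If the sequence of real polynomials (x_n(q))_{n≥0} is strongly q-log-concave, then so is the sequence of window sums (y_k(q))_{k≥0} defined by y_k(q) = x_k(q) + x_{k+1}(q) + ⋯ + x_{k+s}(q). -/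
open Polynomial

/-- For a strongly `q`-log-concave sequence, the product at a pair of indices is dominated
coefficientwise by the product at any pair with the same sum lying between them. -/
lemma coeff_mul_le_coeff_mul_of_strongLogConcave (x : ℕ → ℝ[X])
    (hx : ∀ m n : ℕ, 1 ≤ n → n ≤ m → ∀ t : ℕ,
      0 ≤ (x n * x m - x (n - 1) * x (m + 1)).coeff t) (j : ℕ) :
    ∀ a b : ℕ, a ≤ b → ∀ t : ℕ,
      (x a * x (b + j)).coeff t ≤ (x (a + j) * x b).coeff t := by
  induction j with
  | zero => intro a b _ t; rfl
  | succ j ih =>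
    intro a b hab t
    rcases hab.eq_or_lt with rfl | hlt
    · rw [mul_comm]
    · have hstep := hx (b + j) (a + 1) (by omega) (by omega) t
      rw [coeff_sub, sub_nonneg, Nat.add_sub_cancel, add_assoc b j 1] at hstep
      refine hstep.trans ?_
      rw [add_comm j 1, ← add_assoc]
      exact ih (a + 1) b hlt t

/-- Window sums of length `s + 1` preserve strong `q`-log-concavity. -/
theorem stmt_8 (s : ℕ) (hs : 1 ≤ s) (x : ℕ → ℝ[X])
    (hx : ∀ m n : ℕ, 1 ≤ n → n ≤ m → ∀ t : ℕ,
      0 ≤ (x n * x m - x (n - 1) * x (m + 1)).coeff t)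
    (y : ℕ → ℝ[X])
    (hy : ∀ k : ℕ, y k = ∑ j ∈ Finset.range (s + 1), x (k + j)) :
    ∀ m n : ℕ, 1 ≤ n → n ≤ m → ∀ t : ℕ,
      0 ≤ (y n * y m - y (n - 1) * y (m + 1)).coeff t := by
  intro b n hn hnb t
  obtain ⟨a, rfl⟩ : ∃ a, n = a + 1 := ⟨n - 1, by omega⟩
  rw [Nat.add_sub_cancel]
  have key := coeff_mul_le_coeff_mul_of_strongLogConcave x hx
  have hfirst (k : ℕ) : y k = x k + ∑ j ∈ Finset.range s, x (k + (j + 1)) := by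
    rw [hy, Finset.sum_range_succ', add_zero, add_comm]
  have hlast (k : ℕ) :
      y (k + 1) = (∑ j ∈ Finset.range s, x (k + (j + 1))) + x (k + (s + 1)) := by
    rw [hy, Finset.sum_range_succ]
    simp only [add_assoc, add_comm 1]
  have hdecomp : y (a + 1) * y b - y a * y (b + 1) =
      ∑ j ∈ Finset.range s, (x (a + (j + 1)) * x b - x a * x (b + (j + 1))) +
      (x (a + (s + 1)) * x b - x a * x (b + (s + 1))) +
      ∑ j ∈ Finset.range s,
        (x (a + (s + 1)) * x (b + (j + 1)) - x (a + (j + 1)) * x (b + (s + 1))) := by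
    rw [hlast a, hlast b, hfirst a, hfirst b]
    simp only [Finset.sum_sub_distrib, ← Finset.sum_mul, ← Finset.mul_sum]
    ring
  rw [hdecomp, coeff_add, coeff_add, finsetSum_coeff, finsetSum_coeff]
  refine add_nonneg (add_nonneg (Finset.sum_nonneg fun j _ => ?_) ?_)
    (Finset.sum_nonneg fun j hj => ?_)
  · rw [coeff_sub, sub_nonneg]
    exact key (j + 1) a b (by omega) t
  · rw [coeff_sub, sub_nonneg]
    exact key (s + 1) a b (by omega) t
  · have hjs := Finset.mem_range.mp hj
    have h := key (s - j) (a + (j + 1)) (b + (j + 1)) (by omega) t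
    rw [show b + (j + 1) + (s - j) = b + (s + 1) by omega,
      show a + (j + 1) + (s - j) = a + (s + 1) by omega] at h
    rwa [coeff_sub, sub_nonneg]
end

section
/- Let s be a positive integer. If the sequence of real polynomials (f_k(q))_{k≥0} is strongly q-log-convex, then the bi^s-nomial transform B_n(q) = Σ_{k=0}^{sn} C_s(n,k) f_k(q), n ≥ 0, is also strongly q-log-convex. -/
open Polynomial

/-- The bi^s-nomial coefficient `C_s(n,k)`: the coefficient of `x^k` in
`(1 + x + ⋯ + x^s)^n`. -/
noncomputable def bisnomial (s n k : ℕ) : ℝ :=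
  (((∑ i ∈ Finset.range (s + 1), (X : ℝ[X]) ^ i) ^ n).coeff k)

section SchurCone

variable {R : Type*} [CommRing R]

/-- The complete homogeneous symmetric polynomial of degree `n - 1` in `x` and `y`
(zero for `n = 0`). -/
def homSum (x y : R) : ℕ → R
  | 0 => 0
  | n + 1 => x * homSum x y n + y ^ n

theorem homSum_succ' (x y : R) (n : ℕ) : homSum x y (n + 1) = y * homSum x y n + x ^ n := by
  induction n with
  | zero => simp [homSum]
  | succ n ih =>
    rw [homSum]
    nth_rw 2 [homSum]
    linear_combination x * ih

theorem homSum_mul_sub (x y : R) (n : ℕ) : (y - x) * homSum x y n = y ^ n - x ^ n := by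
  have h := homSum_succ' x y n
  rw [homSum] at h
  linear_combination -h

theorem homSum_add (x y : R) (m n : ℕ) :
    homSum x y (m + n) = x ^ n * homSum x y m + y ^ m * homSum x y n := by
  induction n with
  | zero => simp [homSum]
  | succ n ih => rw [← add_assoc, homSum, ih, homSum]; ring

theorem homSum_succ_mul_succ (x y : R) (m n : ℕ) :
    homSum x y (m + 1) * homSum x y (n + 1) =
      homSum x y (m + n + 1) + x * y * (homSum x y m * homSum x y n) := by
  rw [add_assoc, homSum_add x y m (n + 1), homSum_succ' x y n, homSum]
  ring

/-- The hook `∑ x ^ i * y ^ j` over `max i j = s + 1`, in terms of homogeneous sums. -/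
theorem hook_sum_eq (x y : R) (D : ℕ → R) (hD₀ : D 0 = 0)
    (hD : ∀ s, D (s + 1) = x * y * (D s + homSum x y (s + 1))) (s : ℕ) :
    x ^ (s + 1) * (∑ i ∈ Finset.range (s + 1), y ^ i) +
        y ^ (s + 1) * (∑ i ∈ Finset.range (s + 1), x ^ i) + (x * y) ^ (s + 1) =
      homSum x y (s + 2) + x * y * homSum x y (s + 1) + (x * y - 1) * D s := by
  induction s with
  | zero => simp [homSum, hD₀]
  | succ s ih =>
    rw [hD, Finset.sum_range_succ' (fun i => y ^ i), Finset.sum_range_succ' (fun i => x ^ i)]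
    simp only [pow_succ _ (_ : ℕ), ← Finset.sum_mul] at ih ⊢
    have h₁ := homSum_succ' x y (s + 2)
    have h₂ : homSum x y (s + 2) = x * homSum x y (s + 1) + y ^ (s + 1) := rfl
    simp only [pow_succ _ (_ : ℕ)] at h₁ h₂
    linear_combination x * y * ih - h₁ - y * h₂

variable [Algebra ℝ R]

/-- The cone of Schur-positive expressions in `x` and `y`. -/
def schurCone (x y : R) : Submodule NNReal R :=
  Submodule.span NNReal (Set.range fun a : ℕ × ℕ => (x * y) ^ a.1 * homSum x y a.2)

theorem pow_mul_homSum_mem_schurCone (x y : R) (a n : ℕ) :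
    (x * y) ^ a * homSum x y n ∈ schurCone x y :=
  Submodule.subset_span ⟨(a, n), rfl⟩

theorem homSum_mem_schurCone (x y : R) (n : ℕ) : homSum x y n ∈ schurCone x y := by
  simpa using pow_mul_homSum_mem_schurCone x y 0 n

theorem one_mem_schurCone (x y : R) : (1 : R) ∈ schurCone x y := by
  simpa [homSum] using homSum_mem_schurCone x y 1

theorem pow_mul_homSum_mul_homSum_mem_schurCone (x y : R) (a m n : ℕ) :
    (x * y) ^ a * (homSum x y m * homSum x y n) ∈ schurCone x y := by
  induction m generalizing a n with
  | zero => simp [homSum]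
  | succ m ih =>
    cases n with
    | zero => simp [homSum]
    | succ n =>
      rw [homSum_succ_mul_succ, mul_add, ← mul_assoc, ← pow_succ]
      exact add_mem (pow_mul_homSum_mem_schurCone x y _ _) (ih _ _)

theorem mul_mem_schurCone {x y u v : R} (hu : u ∈ schurCone x y) (hv : v ∈ schurCone x y) :
    u * v ∈ schurCone x y := by
  have h := Submodule.mul_mem_mul hu hv
  rw [schurCone, Submodule.span_mul_span] at h
  refine Submodule.span_le.2 ?_ h
  rintro _ ⟨_, ⟨a, rfl⟩, _, ⟨b, rfl⟩, rfl⟩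
  have h := pow_mul_homSum_mul_homSum_mem_schurCone x y (a.1 + b.1) a.2 b.2
  rwa [pow_add, mul_mul_mul_comm] at h

theorem pow_mem_schurCone {x y u : R} (hu : u ∈ schurCone x y) (n : ℕ) :
    u ^ n ∈ schurCone x y := by
  induction n with
  | zero => simpa using one_mem_schurCone x y
  | succ n ih => rw [pow_succ]; exact mul_mem_schurCone ih hu

theorem geom_sum_mul_geom_sum_mem_schurCone (x y : R) (s : ℕ) :
    (∑ i ∈ Finset.range (s + 1), x ^ i) * (∑ i ∈ Finset.range (s + 1), y ^ i) ∈
      schurCone x y := by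
  let D : ℕ → R := fun s => Nat.rec 0 (fun s d => x * y * (d + homSum x y (s + 1))) s
  have hD : ∀ s, D (s + 1) = x * y * (D s + homSum x y (s + 1)) := fun _ => rfl
  have hxy : x * y ∈ schurCone x y := by
    simpa [homSum] using pow_mul_homSum_mem_schurCone x y 1 1
  have hD_mem : ∀ s, D s ∈ schurCone x y := by
    intro s
    induction s with
    | zero => exact zero_mem _
    | succ s ih =>
      rw [hD]
      exact mul_mem_schurCone hxy (add_mem ih (homSum_mem_schurCone x y _))
  have key : ∀ s, (∑ i ∈ Finset.range (s + 1), x ^ i) * (∑ i ∈ Finset.range (s + 1), y ^ i) =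
      ∑ i ∈ Finset.range (s + 1), homSum x y (i + 1) + D s := by
    intro s
    induction s with
    | zero => simp [homSum, D]
    | succ s ih =>
      rw [Finset.sum_range_succ _ (s + 1), Finset.sum_range_succ _ (s + 1),
        Finset.sum_range_succ _ (s + 1), hD]
      linear_combination ih + hook_sum_eq x y D rfl hD s
  rw [key]
  exact add_mem (sum_mem fun i _ => homSum_mem_schurCone x y _) (hD_mem s)

theorem exists_mem_schurCone_aeval_sub (x y : R) (P : ℝ[X]) (hP : ∀ i, 0 ≤ P.coeff i) :
    ∃ G ∈ schurCone x y, aeval y P - aeval x P = (y - x) * G := by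
  refine ⟨∑ i ∈ Finset.range (P.natDegree + 1), P.coeff i • homSum x y i,
    sum_mem fun i _ => ?_, ?_⟩
  · exact (schurCone x y).smul_mem (⟨P.coeff i, hP i⟩ : NNReal) (homSum_mem_schurCone x y i)
  · simp only [aeval_eq_sum_range, Finset.mul_sum, ← Finset.sum_sub_distrib, mul_smul_comm,
      homSum_mul_sub, smul_sub]

end SchurCone

theorem coeff_pow_nonneg {P : ℝ[X]} (hP : ∀ i, 0 ≤ P.coeff i) (n i : ℕ) :
    0 ≤ (P ^ n).coeff i := by
  induction n generalizing i with
  | zero => rw [pow_zero, coeff_one]; split_ifs <;> norm_num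
  | succ n ih =>
    rw [pow_succ, coeff_mul]
    exact Finset.sum_nonneg fun j _ => mul_nonneg (ih _) (hP _)

/-- The linear map sending `X ^ k` to `f k`. -/
noncomputable def umbralMap (f : ℕ → ℝ[X]) : ℝ[X] →ₗ[ℝ] ℝ[X] :=
  lsum fun k => LinearMap.toSpanSingleton ℝ ℝ[X] (f k)

theorem umbralMap_X_pow (f : ℕ → ℝ[X]) (k : ℕ) : umbralMap f (X ^ k) = f k := by
  simp [umbralMap, lsum_apply, ← monomial_one_right_eq_X_pow, sum_monomial_index]

theorem umbralMap_eq_sum_range (f : ℕ → ℝ[X]) (P : ℝ[X]) {N : ℕ} (hN : P.natDegree < N) :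
    umbralMap f P = ∑ k ∈ Finset.range N, C (P.coeff k) * f k := by
  rw [umbralMap, lsum_apply, P.sum_over_range' _ N hN]
  · simp [smul_eq_C_mul]
  · simp

open scoped TensorProduct

/-- The linear map sending `X ^ a ⊗ X ^ b` to `f a * f b`. -/
noncomputable def umbralMap₂ (f : ℕ → ℝ[X]) : ℝ[X] ⊗[ℝ] ℝ[X] →ₗ[ℝ] ℝ[X] :=
  LinearMap.mul' ℝ ℝ[X] ∘ₗ TensorProduct.map (umbralMap f) (umbralMap f)

theorem umbralMap₂_pow_mul_pow (f : ℕ → ℝ[X]) (P Q : ℝ[X]) (a b : ℕ) :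
    umbralMap₂ f ((P ⊗ₜ 1) ^ a * (1 ⊗ₜ Q) ^ b) = umbralMap f (P ^ a) * umbralMap f (Q ^ b) := by
  simp [umbralMap₂]

theorem coeff_umbralMap₂_nonneg (f : ℕ → ℝ[X])
    (hf : ∀ m n : ℕ, 1 ≤ n → n ≤ m → ∀ t : ℕ,
      0 ≤ (f (n - 1) * f (m + 1) - f n * f m).coeff t)
    {z : ℝ[X] ⊗[ℝ] ℝ[X]} (hz : z ∈ schurCone ((X : ℝ[X]) ⊗ₜ[ℝ] (1 : ℝ[X])) (1 ⊗ₜ X)) (t : ℕ) :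
    0 ≤ (umbralMap₂ f ((1 ⊗ₜ X - X ⊗ₜ 1) ^ 2 * z)).coeff t := by
  set x : ℝ[X] ⊗[ℝ] ℝ[X] := X ⊗ₜ 1 with hx
  set y : ℝ[X] ⊗[ℝ] ℝ[X] := 1 ⊗ₜ X with hy
  induction hz using Submodule.span_induction with
  | mem z hz =>
    obtain ⟨⟨a, k⟩, rfl⟩ := hz
    cases k with
    | zero => simp [homSum]
    | succ k =>
      have h : (y - x) ^ 2 * ((x * y) ^ a * homSum x y (k + 1)) =
          x ^ a * y ^ (a + k + 2) + x ^ (a + k + 2) * y ^ a - x ^ (a + 1) * y ^ (a + k + 1) -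
            x ^ (a + k + 1) * y ^ (a + 1) := by
        linear_combination (y - x) * (x * y) ^ a * homSum_mul_sub x y (k + 1)
      have h' : umbralMap₂ f ((y - x) ^ 2 * ((x * y) ^ a * homSum x y (k + 1))) =
          (f a * f (a + k + 2) - f (a + 1) * f (a + k + 1)) +
            (f a * f (a + k + 2) - f (a + 1) * f (a + k + 1)) := by
        rw [h]
        simp only [map_sub, map_add, hx, hy, umbralMap₂_pow_mul_pow, umbralMap_X_pow]
        ring
      have := hf (a + k + 1) (a + 1) (by omega) (by omega) t
      rw [h', coeff_add]
      exact add_nonneg this this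
  | zero => simp
  | add u v _ _ hu hv => rw [mul_add, map_add, coeff_add]; exact add_nonneg hu hv
  | smul c u _ hu =>
    rw [NNReal.smul_def, mul_smul_comm, map_smul, coeff_smul]
    exact mul_nonneg c.2 hu

/-- The bi^s-nomial transformation preserves strong `q`-log-convexity. -/
theorem stmt_9 (s : ℕ) (hs : 1 ≤ s) (f : ℕ → ℝ[X])
    (hf : ∀ m n : ℕ, 1 ≤ n → n ≤ m → ∀ t : ℕ,
      0 ≤ (f (n - 1) * f (m + 1) - f n * f m).coeff t)
    (B : ℕ → ℝ[X])
    (hB : ∀ n : ℕ, B n = ∑ k ∈ Finset.range (s * n + 1), C (bisnomial s n k) * f k) :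
    ∀ m n : ℕ, 1 ≤ n → n ≤ m → ∀ t : ℕ,
      0 ≤ (B (n - 1) * B (m + 1) - B n * B m).coeff t := by
  intro m n hn hnm t
  obtain ⟨n, rfl⟩ := Nat.exists_eq_add_of_le' hn
  obtain ⟨d, rfl⟩ := Nat.exists_eq_add_of_le hnm
  rw [Nat.add_sub_cancel]
  set p : ℝ[X] := ∑ i ∈ Finset.range (s + 1), X ^ i with hp
  have hBp : ∀ n, B n = umbralMap f (p ^ n) := by
    intro n
    rw [hB, umbralMap_eq_sum_range f (p ^ n) (N := s * n + 1)]
    · rfl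
    · have hdeg : p.natDegree ≤ s := natDegree_sum_le_of_forall_le _ _ fun i hi => by
        rw [natDegree_X_pow]; exact Nat.lt_succ_iff.1 (Finset.mem_range.1 hi)
      have := natDegree_pow_le_of_le n hdeg
      rw [mul_comm] at this
      omega
  have hp_nonneg : ∀ i, 0 ≤ p.coeff i := fun i => by
    rw [hp, finsetSum_coeff]
    exact Finset.sum_nonneg fun j _ => by rw [coeff_X_pow]; split_ifs <;> norm_num
  let x : ℝ[X] ⊗[ℝ] ℝ[X] := X ⊗ₜ 1
  let y : ℝ[X] ⊗[ℝ] ℝ[X] := 1 ⊗ₜ X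
  have hpx : aeval x p = p ⊗ₜ 1 := by
    simpa using aeval_algHom_apply
      (Algebra.TensorProduct.includeLeft : ℝ[X] →ₐ[ℝ] ℝ[X] ⊗[ℝ] ℝ[X]) X p
  have hpy : aeval y p = 1 ⊗ₜ p := by
    simpa using aeval_algHom_apply
      (Algebra.TensorProduct.includeRight : ℝ[X] →ₐ[ℝ] ℝ[X] ⊗[ℝ] ℝ[X]) X p
  obtain ⟨G, hG, hGp⟩ := exists_mem_schurCone_aeval_sub x y p hp_nonneg
  obtain ⟨H, hH, hHp⟩ := exists_mem_schurCone_aeval_sub x y (p ^ (d + 1))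
    (coeff_pow_nonneg hp_nonneg _)
  have hpp : (aeval x p * aeval y p) ∈ schurCone x y := by
    simpa [hp] using geom_sum_mul_geom_sum_mem_schurCone x y s
  rw [map_pow, map_pow] at hHp
  have hpos := coeff_umbralMap₂_nonneg f hf
    (mul_mem_schurCone (pow_mem_schurCone hpp n) (mul_mem_schurCone hG hH)) t
  have h : (y - x) ^ 2 * ((aeval x p * aeval y p) ^ n * (G * H)) =
      aeval x p ^ n * aeval y p ^ (n + d + 2) + aeval x p ^ (n + d + 2) * aeval y p ^ n -
        aeval x p ^ (n + 1) * aeval y p ^ (n + d + 1) -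
        aeval x p ^ (n + d + 1) * aeval y p ^ (n + 1) := by
    calc _ = (aeval x p * aeval y p) ^ n * (((y - x) * G) * ((y - x) * H)) := by ring
      _ = _ := by rw [← hGp, ← hHp]; ring
  have h' : umbralMap₂ f ((y - x) ^ 2 * ((aeval x p * aeval y p) ^ n * (G * H))) =
      (B n * B (n + 1 + d + 1) - B (n + 1) * B (n + 1 + d)) +
        (B n * B (n + 1 + d + 1) - B (n + 1) * B (n + 1 + d)) := by
    rw [h]
    simp only [map_sub, map_add, hpx, hpy, umbralMap₂_pow_mul_pow, hBp]
    rw [show n + 1 + d + 1 = n + d + 2 by ring, show n + 1 + d = n + d + 1 by ring]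
    ring
  rw [h', coeff_add] at hpos
  linarith
end

section
/- Define the Motzkin triangle [M_{n,k}]_{n,k≥0} by M_{0,0} = 1, M_{0,k} = 0 for k > 0, and for n ≥ 1: M_{n,0} = M_{n-1,0} + M_{n-1,1} and M_{n,k} = M_{n-1,k-1} + M_{n-1,k} + M_{n-1,k+1} for k ≥ 1 (entries with k > n being zero). Then for every fixed n, the row sequence (M_{n,k})_{0≤k≤n} is log-concave in k: M_{n,k}^2 ≥ M_{n,k-1} M_{n,k+1} for all k ≥ 1. -/
/-- The Motzkin triangle: `M 0 0 = 1`, `M 0 k = 0` for `k > 0`,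
`M n 0 = M (n-1) 0 + M (n-1) 1` and
`M n k = M (n-1) (k-1) + M (n-1) k + M (n-1) (k+1)` for `k ≥ 1`. -/
def motzkinTriangle : ℕ → ℕ → ℝ
  | 0, 0 => 1
  | 0, _ + 1 => 0
  | n + 1, 0 => motzkinTriangle n 0 + motzkinTriangle n 1
  | n + 1, k + 1 => motzkinTriangle n k + motzkinTriangle n (k + 1) + motzkinTriangle n (k + 2)

/-- The inductive step: summing three consecutive terms of a log-concave sequence without internal
zeros preserves log-concavity. -/
theorem sum_three_mul_le_sq {a b c d e : ℝ} (hb : 0 ≤ b) (hc : 0 ≤ c) (hd : 0 ≤ d)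
    (he : 0 ≤ e) (hcb : 0 < c → 0 < b) (hdc : 0 < d → 0 < c) (hed : 0 < e → 0 < d)
    (hac : a * c ≤ b ^ 2) (hbd : b * d ≤ c ^ 2) (hce : c * e ≤ d ^ 2) :
    (a + b + c) * (c + d + e) ≤ (b + c + d) ^ 2 := by
  have had : a * d ≤ b * c := by
    rcases hd.eq_or_lt with rfl | hd
    · simpa using mul_nonneg hb hc
    have hc := hdc hd
    have hb := hcb hc
    refine le_of_mul_le_mul_right ?_ (mul_pos hb hc)
    calc a * d * (b * c) = (a * c) * (b * d) := by ring
      _ ≤ b ^ 2 * c ^ 2 := by gcongr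
      _ = b * c * (b * c) := by ring
  have hbe : b * e ≤ c * d := by
    rcases he.eq_or_lt with rfl | he
    · simpa using mul_nonneg hc hd
    have hd := hed he
    have hc := hdc hd
    refine le_of_mul_le_mul_right ?_ (mul_pos hc hd)
    calc b * e * (c * d) = (b * d) * (c * e) := by ring
      _ ≤ c ^ 2 * d ^ 2 := by gcongr
      _ = c * d * (c * d) := by ring
  have hae : a * e ≤ b * d := by
    rcases he.eq_or_lt with rfl | he
    · simpa using mul_nonneg hb hd
    have hc := hdc (hed he)
    refine le_of_mul_le_mul_right ?_ (mul_pos hc (hed he))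
    calc a * e * (c * d) = (a * d) * (c * e) := by ring
      _ ≤ (b * c) * d ^ 2 := by gcongr
      _ = b * d * (c * d) := by ring
  nlinarith

theorem motzkinTriangle_nonneg (n k : ℕ) : 0 ≤ motzkinTriangle n k := by
  induction n generalizing k with
  | zero => cases k <;> simp [motzkinTriangle]
  | succ n ih =>
    cases k with
    | zero => exact add_nonneg (ih _) (ih _)
    | succ k => exact add_nonneg (add_nonneg (ih _) (ih _)) (ih _)

theorem motzkinTriangle_pos_of_succ_pos (n k : ℕ) (h : 0 < motzkinTriangle n (k + 1)) :
    0 < motzkinTriangle n k := by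
  induction n generalizing k with
  | zero => simp [motzkinTriangle] at h
  | succ n ih =>
    have hk : 0 < motzkinTriangle n k := by
      by_contra hk
      have h₁ : ¬ 0 < motzkinTriangle n (k + 1) := fun h' => hk (ih k h')
      have h₂ : ¬ 0 < motzkinTriangle n (k + 2) := fun h' => h₁ (ih (k + 1) h')
      rw [motzkinTriangle] at h
      linarith
    cases k with
    | zero => exact add_pos_of_pos_of_nonneg hk (motzkinTriangle_nonneg _ _)
    | succ k =>
      exact add_pos_of_pos_of_nonneg (add_pos_of_nonneg_of_pos (motzkinTriangle_nonneg _ _) hk)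
        (motzkinTriangle_nonneg _ _)

theorem motzkinTriangle_mul_le_sq (n k : ℕ) :
    motzkinTriangle n k * motzkinTriangle n (k + 2) ≤ motzkinTriangle n (k + 1) ^ 2 := by
  have nonneg := motzkinTriangle_nonneg
  have pos := motzkinTriangle_pos_of_succ_pos
  induction n generalizing k with
  | zero => simp [motzkinTriangle]
  | succ n ih =>
    cases k with
    | zero =>
      have h := sum_three_mul_le_sq (a := 0) (nonneg n 0) (nonneg n 1) (nonneg n 2) (nonneg n 3)
        (pos n 0) (pos n 1) (pos n 2) (by simpa using sq_nonneg _) (ih 0) (ih 1)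
      simpa [motzkinTriangle] using h
    | succ k =>
      exact sum_three_mul_le_sq (nonneg n (k + 1)) (nonneg n (k + 2))
        (nonneg n (k + 3)) (nonneg n (k + 4)) (pos n (k + 1)) (pos n (k + 2)) (pos n (k + 3))
        (ih k) (ih (k + 1)) (ih (k + 2))

/-- Each row of the Motzkin triangle is log-concave. -/
theorem stmt_13 :
    ∀ n k : ℕ, 1 ≤ k →
      motzkinTriangle n (k - 1) * motzkinTriangle n (k + 1) ≤ motzkinTriangle n k ^ 2 := by
  intro n k hk
  obtain ⟨k, rfl⟩ := Nat.exists_eq_add_of_le' hk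
  exact motzkinTriangle_mul_le_sq n k
end

section
/- Define Aigner's Catalan triangle [C_{n,k}]_{n,k≥0} by C_{0,0} = 1, C_{0,k} = 0 for k > 0, and for n ≥ 1: C_{n,0} = C_{n-1,0} + C_{n-1,1} and C_{n,k} = C_{n-1,k-1} + 2 C_{n-1,k} + C_{n-1,k+1} for k ≥ 1 (entries with k > n being zero). Then for every fixed n, the row sequence (C_{n,k})_{0≤k≤n} is log-concave in k: C_{n,k}^2 ≥ C_{n,k-1} C_{n,k+1} for all k ≥ 1. -/
/-- Aigner's Catalan triangle: `C 0 0 = 1`, `C 0 k = 0` for `k > 0`,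
`C n 0 = C (n-1) 0 + C (n-1) 1` and
`C n k = C (n-1) (k-1) + 2 C (n-1) k + C (n-1) (k+1)` for `k ≥ 1`. -/
def aignerTriangle : ℕ → ℕ → ℝ
  | 0, 0 => 1
  | 0, _ + 1 => 0
  | n + 1, 0 => aignerTriangle n 0 + aignerTriangle n 1
  | n + 1, k + 1 => aignerTriangle n k + 2 * aignerTriangle n (k + 1) + aignerTriangle n (k + 2)

theorem aignerTriangle_nonneg (n k : ℕ) : 0 ≤ aignerTriangle n k := by
  induction n generalizing k with
  | zero => cases k <;> simp [aignerTriangle]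
  | succ n ih =>
    cases k with
    | zero =>
      rw [aignerTriangle]
      exact add_nonneg (ih 0) (ih 1)
    | succ k =>
      rw [aignerTriangle]
      linarith [ih k, ih (k + 1), ih (k + 2)]

/-- The ratio of consecutive entries in a row, with denominators cleared. -/
theorem aignerTriangle_succ_right (n k : ℕ) :
    (2 * k + 1 : ℝ) * (n + k + 2) * aignerTriangle n (k + 1) =
      (2 * k + 3) * (n - k) * aignerTriangle n k := by
  induction n generalizing k with
  | zero => cases k <;> simp [aignerTriangle]
  | succ n ih =>
    have solve_succ (j : ℕ) : aignerTriangle n (j + 1) =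
        (2 * j + 3) * (n - j) * aignerTriangle n j / ((2 * j + 1) * (n + j + 2)) := by
      rw [eq_div_iff (by positivity), ← ih j]
      ring
    cases k with
    | zero =>
      have h₁ := solve_succ 0
      have h₂ := solve_succ 1
      norm_num at h₁ h₂
      simp only [aignerTriangle]
      rw [h₂, h₁]
      push_cast
      field_simp
      ring
    | succ k =>
      have h₀ := ih k
      have h₂ := solve_succ (k + 1)
      have h₃ := solve_succ (k + 2)
      have h : (n - k : ℝ) * aignerTriangle n k =
          (2 * k + 1) * (n + k + 2) * aignerTriangle n (k + 1) / (2 * k + 3) := by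
        rw [eq_div_iff (by positivity), h₀]
        ring
      simp only [aignerTriangle]
      have expand : (2 * ((k + 1 : ℕ) : ℝ) + 3) * (((n + 1 : ℕ) : ℝ) - ((k + 1 : ℕ) : ℝ)) *
          (aignerTriangle n k + 2 * aignerTriangle n (k + 1) + aignerTriangle n (k + 2)) =
          (2 * k + 5) * ((n - k) * aignerTriangle n k +
            (n - k) * (2 * aignerTriangle n (k + 1) + aignerTriangle n (k + 2))) := by
        push_cast
        ring
      rw [expand, h]
      simp only [add_assoc, Nat.reduceAdd] at h₂ h₃ ⊢
      rw [h₃, h₂]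
      push_cast
      field_simp
      ring

/-- Each row of Aigner's Catalan triangle is log-concave. -/
theorem stmt_15 :
    ∀ n k : ℕ, 1 ≤ k →
      aignerTriangle n (k - 1) * aignerTriangle n (k + 1) ≤ aignerTriangle n k ^ 2 := by
  rintro n (_ | k) hk
  · omega
  rw [Nat.add_sub_cancel]
  have hab := aignerTriangle_succ_right n k
  have hbc := aignerTriangle_succ_right n (k + 1)
  have ha := aignerTriangle_nonneg n k
  have hb := aignerTriangle_nonneg n (k + 1)
  have hc := aignerTriangle_nonneg n (k + 1 + 1)
  push_cast at hbc
  generalize aignerTriangle n k = a at *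
  generalize aignerTriangle n (k + 1) = b at *
  generalize aignerTriangle n (k + 1 + 1) = c at *
  rcases le_or_gt n k with hnk | hnk
  · have hnk' : (n : ℝ) ≤ k := by exact_mod_cast hnk
    have hc0 : c ≤ 0 := by
      have hpos : (0 : ℝ) < (2 * (k + 1) + 1) * (n + (k + 1) + 2) := by positivity
      refine nonpos_of_mul_nonpos_right (a := (2 * (k + 1) + 1) * (n + (k + 1) + 2 : ℝ)) ?_ hpos
      rw [hbc]
      exact mul_nonpos_of_nonpos_of_nonneg
        (mul_nonpos_of_nonneg_of_nonpos (by positivity) (by linarith)) hb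
    nlinarith [mul_nonneg ha hc]
  · obtain ⟨m, rfl⟩ := Nat.exists_eq_add_of_lt hnk
    push_cast at hab hbc
    have ha' : a = (2 * k + 1) * (2 * k + m + 3) * b / ((2 * k + 3) * (m + 1)) := by
      rw [eq_div_iff (by positivity)]
      linear_combination -hab
    have hc' : c = (2 * k + 5) * m * b / ((2 * k + 3) * (2 * k + m + 4)) := by
      rw [eq_div_iff (by positivity)]
      linear_combination hbc
    rw [ha', hc', div_mul_div_comm, div_le_iff₀ (by positivity), ← sub_nonneg]
    have key : (0 : ℝ) ≤ (2 * k + 3) * (m + 1) * ((2 * k + 3) * (2 * k + m + 4)) -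
        (2 * k + 1) * (2 * k + m + 3) * ((2 * k + 5) * m) := by
      ring_nf
      positivity
    linear_combination b ^ 2 * key
end

section
/- Define Aigner's Catalan triangle [C_{n,k}]_{n,k≥0} by C_{0,0} = 1, C_{0,k} = 0 for k > 0, and for n ≥ 1: C_{n,0} = C_{n-1,0} + C_{n-1,1} and C_{n,k} = C_{n-1,k-1} + 2 C_{n-1,k} + C_{n-1,k+1} for k ≥ 1 (entries with k > n being zero). Then the row generating functions C_n(q) = Σ_{k=0}^{n} C_{n,k} q^k, n ≥ 0, form a strongly q-log-convex sequence. -/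
open Polynomial

/-- The generating function of the `n`-th row of Aigner's Catalan triangle. -/
noncomputable def aignerRowGF (n : ℕ) : ℝ[X] :=
  ∑ k ∈ Finset.range (n + 1), C (aignerTriangle n k) * X ^ k

/-- A real polynomial has nonnegative coefficients. -/
def CoeffNonneg (p : ℝ[X]) : Prop := ∀ t, 0 ≤ p.coeff t

namespace CoeffNonneg

lemma zero : CoeffNonneg 0 := fun t => by simp

lemma one : CoeffNonneg 1 := fun t => by
  rw [coeff_one]; split_ifs <;> simp

lemma X : CoeffNonneg (X : ℝ[X]) := fun t => by
  rw [coeff_X]; split_ifs <;> simp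

lemma add {p q : ℝ[X]} (hp : CoeffNonneg p) (hq : CoeffNonneg q) : CoeffNonneg (p + q) :=
  fun t => by rw [coeff_add]; exact add_nonneg (hp t) (hq t)

lemma mul {p q : ℝ[X]} (hp : CoeffNonneg p) (hq : CoeffNonneg q) : CoeffNonneg (p * q) :=
  fun t => by
    rw [coeff_mul]
    exact Finset.sum_nonneg fun _ _ => mul_nonneg (hp _) (hq _)

end CoeffNonneg

/-- All two-by-two minors of the two-row matrix with rows `x`, `y` have nonnegative
coefficients. -/
def MinorsNonneg (x y : ℕ → ℝ[X]) : Prop :=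
  ∀ k l, k ≤ l → CoeffNonneg (x k * y l - x l * y k)

/-- Right multiplication of a row by the lower bidiagonal all-ones matrix. -/
noncomputable def lowerStep (x : ℕ → ℝ[X]) (k : ℕ) : ℝ[X] := x k + x (k + 1)

/-- Right multiplication of a row by the upper bidiagonal matrix whose entries are `1`, except
for the top left corner `1 + X`. -/
noncomputable def upperStep (x : ℕ → ℝ[X]) : ℕ → ℝ[X]
  | 0 => (1 + X) * x 0
  | k + 1 => x k + x (k + 1)

lemma MinorsNonneg.lowerStep {x y : ℕ → ℝ[X]} (h : MinorsNonneg x y) :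
    MinorsNonneg (lowerStep x) (lowerStep y) := by
  intro k l hkl
  obtain rfl | hlt := hkl.eq_or_lt
  · simpa [mul_comm] using CoeffNonneg.zero
  · have := (((h k l hkl).add (h k (l + 1) (by lia))).add (h (k + 1) l hlt)).add
      (h (k + 1) (l + 1) (by lia))
    convert this using 1
    simp only [_root_.lowerStep]
    ring

lemma MinorsNonneg.upperStep {x y : ℕ → ℝ[X]} (h : MinorsNonneg x y) :
    MinorsNonneg (upperStep x) (upperStep y) := by
  rintro (_ | k) (_ | l) hkl
  · simpa [mul_comm] using CoeffNonneg.zero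
  · have := (CoeffNonneg.one.add CoeffNonneg.X).mul
      ((h 0 l (by lia)).add (h 0 (l + 1) (by lia)))
    convert this using 1
    simp only [_root_.upperStep]
    ring
  · lia
  · exact h.lowerStep k l (by lia)

/-- The polynomials `∑ j, C n (k + j) * X ^ j` built from Aigner's triangle, presented by a
recurrence whose production matrix is a product of bidiagonal matrices. -/
noncomputable def aignerTail : ℕ → ℕ → ℝ[X]
  | 0 => fun k => if k = 0 then 1 else 0
  | n + 1 => upperStep (lowerStep (aignerTail n))

lemma aignerTail_eq_add (n k : ℕ) :
    aignerTail n k = C (aignerTriangle n k) + X * aignerTail n (k + 1) := by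
  induction n generalizing k with
  | zero => cases k <;> simp [aignerTail, aignerTriangle]
  | succ n ih =>
    cases k with
    | zero =>
      simp only [aignerTail, upperStep, lowerStep, aignerTriangle, C_add]
      linear_combination ih 0 + ih 1
    | succ k =>
      simp only [aignerTail, upperStep, lowerStep, aignerTriangle, C_add, C_mul]
      have h2 : (C 2 : ℝ[X]) = 2 := rfl
      rw [h2]
      linear_combination ih k + 2 * ih (k + 1) + ih (k + 2)

lemma aignerTail_eq_zero {n k : ℕ} (h : n < k) : aignerTail n k = 0 := by
  induction n generalizing k with
  | zero => simp [aignerTail, h.ne']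
  | succ n ih =>
    obtain ⟨k, rfl⟩ := Nat.exists_eq_succ_of_ne_zero (show k ≠ 0 by lia)
    simp only [aignerTail, upperStep, lowerStep]
    simp [ih (show n < k by lia), ih (show n < k + 1 by lia), ih (show n < k + 1 + 1 by lia)]

lemma aignerTail_zero_eq_sum_add (n N : ℕ) :
    aignerTail n 0 =
      ∑ k ∈ Finset.range N, C (aignerTriangle n k) * X ^ k + X ^ N * aignerTail n N := by
  induction N with
  | zero => simp
  | succ N ih =>
    rw [Finset.sum_range_succ, ih, aignerTail_eq_add n N]
    ring

lemma aignerRowGF_eq_aignerTail (n : ℕ) : aignerRowGF n = aignerTail n 0 := by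
  rw [aignerTail_zero_eq_sum_add n (n + 1), aignerTail_eq_zero n.lt_succ_self, aignerRowGF]
  simp

lemma coeffNonneg_aignerTail (n k : ℕ) : CoeffNonneg (aignerTail n k) := by
  induction n generalizing k with
  | zero =>
    simp only [aignerTail]
    split_ifs
    exacts [CoeffNonneg.one, CoeffNonneg.zero]
  | succ n ih =>
    cases k with
    | zero => exact (CoeffNonneg.one.add CoeffNonneg.X).mul ((ih 0).add (ih 1))
    | succ k => exact ((ih k).add (ih _)).add ((ih _).add (ih _))

lemma minorsNonneg_aignerTail (n d : ℕ) :
    MinorsNonneg (aignerTail n) (aignerTail (n + d)) := by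
  induction n with
  | zero =>
    rintro (_ | k) (_ | l) hkl
    · simpa [mul_comm] using CoeffNonneg.zero
    · simpa [aignerTail] using coeffNonneg_aignerTail d (l + 1)
    · lia
    · simpa [aignerTail] using CoeffNonneg.zero
  | succ n ih =>
    rw [Nat.succ_add]
    exact ih.lowerStep.upperStep

/-- The row generating functions of Aigner's Catalan triangle form a strongly
`q`-log-convex sequence. -/
theorem stmt_16 :
    ∀ m n : ℕ, 1 ≤ n → n ≤ m → ∀ t : ℕ,
      0 ≤ (aignerRowGF (n - 1) * aignerRowGF (m + 1) -
            aignerRowGF n * aignerRowGF m).coeff t := by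
  intro m n hn hnm
  obtain ⟨n, rfl⟩ := Nat.exists_eq_add_of_le' hn
  obtain ⟨d, rfl⟩ := Nat.exists_eq_add_of_le (show n ≤ m by lia)
  have := (CoeffNonneg.one.add CoeffNonneg.X).mul
    (minorsNonneg_aignerTail n d 0 1 zero_le_one)
  change CoeffNonneg _
  convert this using 1
  simp only [aignerRowGF_eq_aignerTail, Nat.add_sub_cancel, aignerTail, upperStep, lowerStep]
  ring
end

section
/- Let α, β, γ, e, f, g, h be nonnegative real constants and let [A_{n,k}]_{n,k≥0} be the array defined by A_{0,0} = 1, A_{0,k} = 0 for k > 0, and for n ≥ 1: A_{n,0} = α A_{n-1,0} + g A_{n-1,1} + h A_{n-1,2}; A_{n,1} = β A_{n-1,0} + f A_{n-1,1} + g A_{n-1,2} + h A_{n-1,3}; and A_{n,k} = γ A_{n-1,k-2} + e A_{n-1,k-1} + f A_{n-1,k} + g A_{n-1,k+1} + h A_{n-1,k+2} for k ≥ 2 (terms with out-of-range index being zero). Define b_{n,k}(q) = Σ_{i≥k} A_{n,i} q^i. Then for all n ≥ 1: b_{n,0}(q) = (α + βq + γq^2) b_{n-1,0}(q) + [g/q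 + (f−α) + (e−β)q] b_{n-1,1}(q) + (h/q^2) b_{n-1,2}(q), and for k ≥ 2: b_{n,k}(q) = γ q^2 b_{n-1,k-2}(q) + e q b_{n-1,k-1}(q) + f b_{n-1,k}(q) + (g/q) b_{n-1,k+1}(q) + (h/q^2) b_{n-1,k+2}(q), where these identities are identities of Laurent polynomials in q (each division by a power of q being exact). -/
open LaurentPolynomial

/-- The partial-sum generating functions `b_{n,k}(q) = Σ_{i ≥ k} A_{n,i} q^i` of
the generalized triangular array satisfy, in `ℝ[q, q⁻¹]`, the recurrences
`b_{n,0} = (α + βq + γq²) b_{n-1,0} + (g/q + (f-α) + (e-β)q) b_{n-1,1}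
+ (h/q²) b_{n-1,2}` and, for `k ≥ 2`,
`b_{n,k} = γq² b_{n-1,k-2} + eq b_{n-1,k-1} + f b_{n-1,k} + (g/q) b_{n-1,k+1}
+ (h/q²) b_{n-1,k+2}`. -/
theorem stmt_18 (α β γ e f g h : ℝ)
    (hα : 0 ≤ α) (hβ : 0 ≤ β) (hγ : 0 ≤ γ) (he : 0 ≤ e) (hf : 0 ≤ f)
    (hg : 0 ≤ g) (hh : 0 ≤ h)
    (A : ℕ → ℕ → ℝ)
    (hA00 : A 0 0 = 1)
    (hA0k : ∀ k : ℕ, 0 < k → A 0 k = 0)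
    (hAhigh : ∀ n k : ℕ, 2 * n < k → A n k = 0)
    (hrec0 : ∀ n : ℕ, 1 ≤ n →
      A n 0 = α * A (n - 1) 0 + g * A (n - 1) 1 + h * A (n - 1) 2)
    (hrec1 : ∀ n : ℕ, 1 ≤ n →
      A n 1 = β * A (n - 1) 0 + f * A (n - 1) 1 + g * A (n - 1) 2 + h * A (n - 1) 3)
    (hrec : ∀ n : ℕ, 1 ≤ n → ∀ k : ℕ, 2 ≤ k →
      A n k = γ * A (n - 1) (k - 2) + e * A (n - 1) (k - 1) + f * A (n - 1) k
        + g * A (n - 1) (k + 1) + h * A (n - 1) (k + 2))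
    (b : ℕ → ℕ → ℝ[T;T⁻¹])
    (hb : ∀ n k : ℕ, b n k =
      ∑ i ∈ Finset.Icc k (2 * n), LaurentPolynomial.C (A n i) * T (i : ℤ)) :
    ∀ n : ℕ, 1 ≤ n →
      (b n 0 =
        (LaurentPolynomial.C α + LaurentPolynomial.C β * T 1
            + LaurentPolynomial.C γ * T 2) * b (n - 1) 0
        + (LaurentPolynomial.C g * T (-1) + LaurentPolynomial.C (f - α)
            + LaurentPolynomial.C (e - β) * T 1) * b (n - 1) 1
        + LaurentPolynomial.C h * T (-2) * b (n - 1) 2) ∧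
      (∀ k : ℕ, 2 ≤ k →
        b n k =
          LaurentPolynomial.C γ * T 2 * b (n - 1) (k - 2)
          + LaurentPolynomial.C e * T 1 * b (n - 1) (k - 1)
          + LaurentPolynomial.C f * b (n - 1) k
          + LaurentPolynomial.C g * T (-1) * b (n - 1) (k + 1)
          + LaurentPolynomial.C h * T (-2) * b (n - 1) (k + 2)) := by
  have peel : ∀ n k : ℕ, b n k = C (A n k) * T 1 ^ k + b n (k + 1) := by
    intro n k
    rw [hb, hb, T_pow, mul_one]
    rcases le_or_gt k (2 * n) with hk | hk
    · rw [← Finset.insert_Icc_add_one_left_eq_Icc hk, Finset.sum_insert (by simp)]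
    · rw [Finset.Icc_eq_empty (by omega), Finset.Icc_eq_empty (by omega), hAhigh n k hk]
      simp
  have hxy : (T 1 : ℝ[T;T⁻¹]) * T (-1) = 1 := by
    rw [← T_add, ← T_zero]
    norm_num
  have hT2 : (T 2 : ℝ[T;T⁻¹]) = T 1 ^ 2 := by
    rw [T_pow]
    norm_num
  have hTneg2 : (T (-2) : ℝ[T;T⁻¹]) = T (-1) ^ 2 := by
    rw [T_pow]
    norm_num
  rintro (_ | m) hm
  · omega
  simp only [Nat.add_sub_cancel, hT2, hTneg2]
  have tail : ∀ j : ℕ, b (m + 1) (j + 2) =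
      C γ * T 1 ^ 2 * b m j + C e * T 1 * b m (j + 1) + C f * b m (j + 2)
        + C g * T (-1) * b m (j + 3) + C h * T (-1) ^ 2 * b m (j + 4) := by
    have vanish : ∀ n k : ℕ, 2 * n < k → b n k = 0 := by
      intro n k hk
      rw [hb, Finset.Icc_eq_empty (by omega), Finset.sum_empty]
    have large : ∀ j : ℕ, 2 * m + 1 ≤ j → b (m + 1) (j + 2) =
        C γ * T 1 ^ 2 * b m j + C e * T 1 * b m (j + 1) + C f * b m (j + 2)
          + C g * T (-1) * b m (j + 3) + C h * T (-1) ^ 2 * b m (j + 4) := by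
      intro j hj
      rw [vanish (m + 1) _ (by omega), vanish m j (by omega), vanish m (j + 1) (by omega),
        vanish m (j + 2) (by omega), vanish m (j + 3) (by omega), vanish m (j + 4) (by omega)]
      simp
    intro j
    rcases le_total j (2 * m + 1) with hj | hj
    · induction hj using Nat.decreasingInduction with
      | self => exact large _ le_rfl
      | of_succ j _ ih =>
        have hA := hrec (m + 1) hm (j + 2) (by omega)
        simp only [Nat.add_sub_cancel, show j + 2 - 1 = j + 1 by omega, add_assoc,
          Nat.reduceAdd] at hA ih
        have h0 := peel m j
        have h1 := peel m (j + 1)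
        have h2 := peel m (j + 2)
        have h3 := peel m (j + 3)
        have h4 := peel m (j + 4)
        rw [peel (m + 1) (j + 2), hA]
        simp only [map_add, map_mul, add_assoc, Nat.reduceAdd] at h1 h2 h3 h4 ⊢
        linear_combination ih - C γ * T 1 ^ 2 * h0 - C e * T 1 * h1 - C f * h2
          - C g * T (-1) * h3 - C h * T (-1) ^ 2 * h4
          - C g * C (A m (j + 3)) * T 1 ^ (j + 2) * hxy
          - C h * C (A m (j + 4)) * T 1 ^ (j + 2) * (T 1 * T (-1) + 1) * hxy
    · exact large j hj
  refine ⟨?_, fun k hk => ?_⟩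
  · have h0 := peel m 0
    have h1 := peel m 1
    have h2 := peel m 2
    have h3 := peel m 3
    have t0 := tail 0
    rw [peel (m + 1) 0, peel (m + 1) 1, hrec0 (m + 1) hm, hrec1 (m + 1) hm]
    simp only [Nat.add_sub_cancel, map_add, map_mul, map_sub, zero_add, Nat.reduceAdd, pow_zero, pow_one, mul_one]
      at h0 h1 h2 h3 t0 ⊢
    linear_combination t0
      - (C α + C β * T 1) * h0
      - (C g * T (-1) + C f) * h1
      - (C g * T (-1) + C h * T (-1) ^ 2) * h2
      - C h * T (-1) ^ 2 * h3
      - (C g * C (A m 1) + C g * C (A m 2) * T 1) * hxy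
      - (C h * C (A m 2) + C h * C (A m 3) * T 1) * (T 1 * T (-1) + 1) * hxy
  · obtain ⟨j, rfl⟩ := Nat.exists_eq_add_of_le' hk
    simpa only [Nat.add_sub_cancel, show j + 2 - 1 = j + 1 by omega, add_assoc,
      Nat.reduceAdd] using tail j
end
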